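/- arXiv:1609.00139 — 10 statements merged into one kernel-verified Lean document; each statement's English description precedes it below -/
import Mathlib

section
/- (Proposition 3.1, case q ≠ 0.) Let e > 0, q ≠ 0 and η ∈ ℝ satisfy η > e² + q²/e. Then there exists a unique quintuple (ρ₁, ρ₂, v₁, v₂, σ) ∈ ℝ⁵ with ρ₁ > 0, ρ₂ > 0, σ > 0 and v₁ < v₂ that solves the centered two-node Gaussian-EQMOM system with parameters (e, q, η). -/
/-- The centered two-node Gaussian-EQMOM system with parameters `(e, q, η)`
in the unknowns `(ρ₁, ρ₂, v₁, v₂, σ)`. -/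
def CenteredEQMOM (e q η ρ₁ ρ₂ v₁ v₂ σ : ℝ) : Prop :=
  ρ₁ + ρ₂ = 1 ∧
  ρ₁ * v₁ + ρ₂ * v₂ = 0 ∧
  ρ₁ * v₁ ^ 2 + ρ₂ * v₂ ^ 2 = e - σ ^ 2 ∧
  ρ₁ * v₁ ^ 3 + ρ₂ * v₂ ^ 3 = q ∧
  ρ₁ * v₁ ^ 4 + ρ₂ * v₂ ^ 4 = η - 6 * σ ^ 2 * e + 3 * σ ^ 4

/-- For `k > 0`, the cubic `2 * x ^ 3 + c * x - k` has at most one positive root. -/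
lemma cubic_pos_root_unique {c k x y : ℝ} (hk : 0 < k) (hx : 0 < x) (hy : 0 < y)
    (hfx : 2 * x ^ 3 + c * x = k) (hfy : 2 * y ^ 3 + c * y = k) : x = y := by
  have h : (x - y) * (2 * (x * y) * (x + y) + k) = 0 := by
    linear_combination y * hfx - x * hfy
  rcases mul_eq_zero.mp h with h | h
  · linarith
  · have : 0 < 2 * (x * y) * (x + y) + k := by positivity
    linarith

/-- If `2 * e ^ 3 + c * e > k > 0` with `e > 0`, the cubic `2 * x ^ 3 + c * x - k` has a root
in `(0, e)`. -/
lemma exists_cubic_root {c k e : ℝ} (he : 0 < e) (hk : 0 < k)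
    (hke : k < 2 * e ^ 3 + c * e) : ∃ m, 0 < m ∧ m < e ∧ 2 * m ^ 3 + c * m = k := by
  have hcont : ContinuousOn (fun x : ℝ => 2 * x ^ 3 + c * x) (Set.Icc 0 e) := by fun_prop
  obtain ⟨m, ⟨hm0, hme⟩, hm⟩ :=
    intermediate_value_Ioo he.le hcont (show k ∈ Set.Ioo _ _ from ⟨by simpa using hk, hke⟩)
  exact ⟨m, hm0, hme, hm⟩

/-- The moment system in terms of the cubic satisfied by `m = e - σ ^ 2`. -/
lemma centeredEQMOM_iff {e q η ρ₁ ρ₂ v₁ v₂ σ : ℝ} (hm : e - σ ^ 2 ≠ 0) :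
    CenteredEQMOM e q η ρ₁ ρ₂ v₁ v₂ σ ↔
      ρ₁ + ρ₂ = 1 ∧ ρ₁ * v₁ + ρ₂ * v₂ = 0 ∧ -(v₁ * v₂) = e - σ ^ 2 ∧
      (v₁ + v₂) * (e - σ ^ 2) = q ∧
      2 * (e - σ ^ 2) ^ 3 + (η - 3 * e ^ 2) * (e - σ ^ 2) = q ^ 2 := by
  unfold CenteredEQMOM
  constructor
  · rintro ⟨h0, h1, h2, h3, h4⟩
    have hp : -(v₁ * v₂) = e - σ ^ 2 := by
      linear_combination h2 - (v₁ + v₂) * h1 + v₁ * v₂ * h0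
    have hs : (v₁ + v₂) * (e - σ ^ 2) = q := by
      linear_combination h3 - (v₁ + v₂) * h2 + v₁ * v₂ * h1
    have h4' : (v₁ + v₂) * q + (e - σ ^ 2) ^ 2 = η - 6 * σ ^ 2 * e + 3 * σ ^ 4 := by
      linear_combination h4 - (v₁ + v₂) * h3 + v₁ * v₂ * h2 - (e - σ ^ 2) * hp
    refine ⟨h0, h1, hp, hs, ?_⟩
    linear_combination q * hs - (e - σ ^ 2) * h4'
  · rintro ⟨h0, h1, hp, hs, hc⟩
    have h2 : ρ₁ * v₁ ^ 2 + ρ₂ * v₂ ^ 2 = e - σ ^ 2 := by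
      linear_combination hp + (v₁ + v₂) * h1 - v₁ * v₂ * h0
    have h3 : ρ₁ * v₁ ^ 3 + ρ₂ * v₂ ^ 3 = q := by
      linear_combination hs + (v₁ + v₂) * h2 - v₁ * v₂ * h1
    have h4 : (v₁ + v₂) * q + (e - σ ^ 2) ^ 2 = η - 6 * σ ^ 2 * e + 3 * σ ^ 4 := by
      apply mul_left_cancel₀ hm
      linear_combination q * hs - hc
    refine ⟨h0, h1, h2, h3, ?_⟩
    linear_combination h4 + (v₁ + v₂) * h3 - v₁ * v₂ * h2 + (e - σ ^ 2) * hp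

/-- An ordered pair of reals is determined by its sum and product. -/
lemma ordered_pair_unique {a b c d : ℝ} (hab : a < b) (hcd : c < d)
    (hs : a + b = c + d) (hp : a * b = c * d) : a = c ∧ b = d := by
  have hd : b - a = d - c := by
    rw [← sq_eq_sq₀ (by linarith) (by linarith)]
    linear_combination (a + b + c + d) * hs - 4 * hp
  constructor <;> linarith

/-- Two weights with given total and given first moment at distinct nodes are unique. -/
lemma weights_unique {r₁ r₂ s₁ s₂ a b : ℝ} (hab : a < b) (h : r₁ + r₂ = s₁ + s₂)
    (h' : r₁ * a + r₂ * b = s₁ * a + s₂ * b) : r₁ = s₁ ∧ r₂ = s₂ := by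
  have h₁ : r₁ = s₁ := by
    apply mul_right_cancel₀ (sub_ne_zero.mpr hab.ne')
    linear_combination b * h - h'
  exact ⟨h₁, by linarith⟩

/-- The central variance of the nodes in a solution is positive. -/
lemma CenteredEQMOM.pos_sub_sq {e q η ρ₁ ρ₂ v₁ v₂ σ : ℝ}
    (h : CenteredEQMOM e q η ρ₁ ρ₂ v₁ v₂ σ) (h₁ : 0 < ρ₁) (h₂ : 0 < ρ₂) (hv : v₁ < v₂) :
    0 < e - σ ^ 2 := by
  obtain ⟨h0, hm, h2, -, -⟩ := h
  have key : e - σ ^ 2 = ρ₁ * ρ₂ * (v₂ - v₁) ^ 2 := by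
    linear_combination -h2 + (ρ₁ * v₁ ^ 2 + ρ₂ * v₂ ^ 2) * -h0 +
      (ρ₁ * v₁ + ρ₂ * v₂) * hm
  rw [key]
  have := sub_pos.mpr hv
  positivity

/-- For `m > 0` there are two ordered nodes with product `-m` and prescribed sum, carrying
positive weights of total `1` and mean `0`. -/
lemma exists_nodes_weights {m : ℝ} (s : ℝ) (hm : 0 < m) :
    ∃ ρ₁ ρ₂ v₁ v₂ : ℝ, 0 < ρ₁ ∧ 0 < ρ₂ ∧ v₁ < v₂ ∧ ρ₁ + ρ₂ = 1 ∧
      ρ₁ * v₁ + ρ₂ * v₂ = 0 ∧ -(v₁ * v₂) = m ∧ v₁ + v₂ = s := by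
  obtain ⟨D, hD, hD2⟩ : ∃ D : ℝ, 0 < D ∧ D ^ 2 = s ^ 2 + 4 * m :=
    ⟨√(s ^ 2 + 4 * m), by positivity, Real.sq_sqrt (by positivity)⟩
  obtain ⟨hl, hr⟩ := abs_lt.mp (abs_lt_of_sq_lt_sq (show s ^ 2 < D ^ 2 by linarith) hD.le)
  refine ⟨(s + D) / 2 / D, (D - s) / 2 / D, (s - D) / 2, (s + D) / 2, ?_, ?_, ?_, ?_, ?_, ?_, ?_⟩
  · exact div_pos (by linarith) hD
  · exact div_pos (by linarith) hD
  · linarith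
  · field_simp
    ring
  · field_simp
    ring
  · linear_combination hD2 / 4
  · ring

/-- Proposition 3.1, case `q ≠ 0`. -/
theorem prop31_q_ne_zero (e q η : ℝ) (he : 0 < e) (hq : q ≠ 0)
    (hη : e ^ 2 + q ^ 2 / e < η) :
    ∃! p : ℝ × ℝ × ℝ × ℝ × ℝ,
      0 < p.1 ∧ 0 < p.2.1 ∧ p.2.2.1 < p.2.2.2.1 ∧ 0 < p.2.2.2.2 ∧
      CenteredEQMOM e q η p.1 p.2.1 p.2.2.1 p.2.2.2.1 p.2.2.2.2 := by
  have hq2 : 0 < q ^ 2 := by positivity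
  have hend : q ^ 2 < 2 * e ^ 3 + (η - 3 * e ^ 2) * e := by
    have h := mul_lt_mul_of_pos_right hη he
    rw [add_mul, div_mul_cancel₀ _ he.ne'] at h
    linarith
  obtain ⟨m, hm0, hme, hm⟩ := exists_cubic_root he hq2 hend
  obtain ⟨ρ₁, ρ₂, v₁, v₂, hρ₁, hρ₂, hv, h0, h1, hp, hs⟩ := exists_nodes_weights (q / m) hm0
  obtain ⟨σ, hσ, hσm⟩ : ∃ σ : ℝ, 0 < σ ∧ e - σ ^ 2 = m :=
    ⟨√(e - m), Real.sqrt_pos.mpr (by linarith), by rw [Real.sq_sqrt (by linarith)]; ring⟩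
  subst hσm
  have hsq : (v₁ + v₂) * (e - σ ^ 2) = q := by rw [hs, div_mul_cancel₀ _ hm0.ne']
  refine ⟨(ρ₁, ρ₂, v₁, v₂, σ), ⟨hρ₁, hρ₂, hv, hσ,
    (centeredEQMOM_iff hm0.ne').mpr ⟨h0, h1, hp, hsq, hm⟩⟩, ?_⟩
  rintro ⟨r₁, r₂, w₁, w₂, τ⟩ ⟨hr₁, hr₂, hw, hτ, hsol⟩
  dsimp only at hr₁ hr₂ hw hτ hsol
  have hτ0 := hsol.pos_sub_sq hr₁ hr₂ hw
  obtain ⟨k0, k1, kp, ks, kc⟩ := (centeredEQMOM_iff hτ0.ne').mp hsol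
  have hvar : e - τ ^ 2 = e - σ ^ 2 := cubic_pos_root_unique hq2 hτ0 hm0 kc hm
  obtain rfl : τ = σ := (sq_eq_sq₀ hτ.le hσ.le).mp (by linarith)
  obtain ⟨rfl, rfl⟩ := ordered_pair_unique hw hv
    (mul_right_cancel₀ hm0.ne' (ks.trans hsq.symm)) (by linarith)
  obtain ⟨rfl, rfl⟩ := weights_unique hw (k0.trans h0.symm) (k1.trans h1.symm)
  rfl
end

section
/- (Proposition 3.1, case q = 0.) Let e > 0 and η ∈ ℝ satisfy e² < η ≤ 3e². Then there exist unique real numbers v ≥ 0 and σ > 0 such that 2v⁴ = 3e² − η and v² + σ² = e; moreover, the quintuple (ρ₁, ρ₂, v₁, v₂, σ) = (1/2, 1/2, −v, v, σ) solves the centered two-node Gaussian-EQMOM system with parameters (e, 0, η). -/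
/-- Proposition 3.1, case `q = 0`. -/
theorem prop31_q_eq_zero (e η : ℝ) (he : 0 < e) (h1 : e ^ 2 < η) (h2 : η ≤ 3 * e ^ 2) :
    (∃! p : ℝ × ℝ,
      (0 ≤ p.1 ∧ 0 < p.2) ∧ 2 * p.1 ^ 4 = 3 * e ^ 2 - η ∧ p.1 ^ 2 + p.2 ^ 2 = e) ∧
    ∀ v σ : ℝ, 0 ≤ v → 0 < σ → 2 * v ^ 4 = 3 * e ^ 2 - η → v ^ 2 + σ ^ 2 = e →
      CenteredEQMOM e 0 η (1 / 2) (1 / 2) (-v) v σ := by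
  constructor
  · set w := √((3 * e ^ 2 - η) / 2)
    have hw0 : 0 ≤ w := Real.sqrt_nonneg _
    have hw2 : w ^ 2 = (3 * e ^ 2 - η) / 2 := Real.sq_sqrt (by linarith)
    have hwe : w < e := lt_of_pow_lt_pow_left₀ 2 he.le (by linarith)
    have hv2 : √w ^ 2 = w := Real.sq_sqrt hw0
    have hσ2 : √(e - w) ^ 2 = e - w := Real.sq_sqrt (by linarith)
    refine ⟨(√w, √(e - w)), ⟨⟨Real.sqrt_nonneg _, Real.sqrt_pos.2 (by linarith)⟩, ?_, ?_⟩, ?_⟩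
    · linear_combination 2 * (√w ^ 2 + w) * hv2 + 2 * hw2
    · linear_combination hv2 + hσ2
    · rintro ⟨v, σ⟩ ⟨⟨hv, hσ⟩, h4, hsum⟩
      dsimp only at hv hσ h4 hsum
      have hvw : v ^ 2 = w :=
        (pow_left_inj₀ (sq_nonneg v) hw0 two_ne_zero).1 (by linear_combination h4 / 2 - hw2)
      have hσw : e - w = σ ^ 2 := by linarith
      rw [hσw, ← hvw, Real.sqrt_sq hv, Real.sqrt_sq hσ.le]
  · intro v σ _ _ h4 hsum
    obtain rfl : e = v ^ 2 + σ ^ 2 := hsum.symm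
    refine ⟨by norm_num, by ring, by ring, by ring, ?_⟩
    linear_combination -h4
end

section
/- (Reduction to centered variables.) Let M₀ > 0 and M₁, M₂, M₃, M₄ ∈ ℝ, and define e = (M₀M₂−M₁²)/M₀², q = ((M₃M₀²−M₁³)−3M₁(M₀M₂−M₁²))/M₀³ and η = (−3M₁⁴+M₄M₀³−4M₀²M₁M₃+6M₀M₁²M₂)/M₀⁴. Then a quintuple (ρ₁, ρ₂, v₁, v₂, σ) ∈ ℝ⁵ satisfies the quadrature system M₀ = ρ₁+ρ₂, M₁ = ρ₁v₁+ρ₂v₂, M₂−σ²M₀ = ρ₁v₁²+ρ₂v₂², M₃−3σ²M₁ = ρ₁v₁³+ρ₂v₂³, M₄−6σ²M₂+3σ⁴M₀ = ρ₁v₁⁴+ρ₂v₂⁴ if and only if the quintuple (ρ₁/M₀, ρ₂/M₀, v₁−M₁/M₀, v₂−M₁/M₀, σ) satisfies the centered two-node Gaussian-EQMOM system with parameters (e, q, η). -/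
/-- Reduction to centered variables for raw moments `m, n₂, n₃, n₄` of total mass one. -/
theorem centeredEQMOM_of_unit_mass (m n₂ n₃ n₄ r₁ r₂ v₁ v₂ σ : ℝ) :
    (r₁ + r₂ = 1 ∧
     r₁ * v₁ + r₂ * v₂ = m ∧
     r₁ * v₁ ^ 2 + r₂ * v₂ ^ 2 = n₂ - σ ^ 2 ∧
     r₁ * v₁ ^ 3 + r₂ * v₂ ^ 3 = n₃ - 3 * σ ^ 2 * m ∧
     r₁ * v₁ ^ 4 + r₂ * v₂ ^ 4 = n₄ - 6 * σ ^ 2 * n₂ + 3 * σ ^ 4)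
    ↔ CenteredEQMOM (n₂ - m ^ 2) (n₃ - 3 * m * n₂ + 2 * m ^ 3)
        (n₄ - 4 * m * n₃ + 6 * m ^ 2 * n₂ - 3 * m ^ 4) r₁ r₂ (v₁ - m) (v₂ - m) σ := by
  constructor
  · rintro ⟨h0, h1, h2, h3, h4⟩
    refine ⟨h0, ?_, ?_, ?_, ?_⟩
    · linear_combination h1 - m * h0
    · linear_combination h2 - 2 * m * h1 + m ^ 2 * h0
    · linear_combination h3 - 3 * m * h2 + 3 * m ^ 2 * h1 - m ^ 3 * h0
    · linear_combination h4 - 4 * m * h3 + 6 * m ^ 2 * h2 - 4 * m ^ 3 * h1 + m ^ 4 * h0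
  · rintro ⟨h0, h1, h2, h3, h4⟩
    refine ⟨h0, ?_, ?_, ?_, ?_⟩
    · linear_combination h1 + m * h0
    · linear_combination h2 + 2 * m * h1 + m ^ 2 * h0
    · linear_combination h3 + 3 * m * h2 + 3 * m ^ 2 * h1 + m ^ 3 * h0
    · linear_combination h4 + 4 * m * h3 + 6 * m ^ 2 * h2 + 4 * m ^ 3 * h1 + m ^ 4 * h0

/-- Reduction to centered variables. -/
theorem reduction_to_centered (M₀ M₁ M₂ M₃ M₄ : ℝ) (hM₀ : 0 < M₀)
    (ρ₁ ρ₂ v₁ v₂ σ : ℝ) :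
    (M₀ = ρ₁ + ρ₂ ∧
     M₁ = ρ₁ * v₁ + ρ₂ * v₂ ∧
     M₂ - σ ^ 2 * M₀ = ρ₁ * v₁ ^ 2 + ρ₂ * v₂ ^ 2 ∧
     M₃ - 3 * σ ^ 2 * M₁ = ρ₁ * v₁ ^ 3 + ρ₂ * v₂ ^ 3 ∧
     M₄ - 6 * σ ^ 2 * M₂ + 3 * σ ^ 4 * M₀ = ρ₁ * v₁ ^ 4 + ρ₂ * v₂ ^ 4)
    ↔ CenteredEQMOM
        ((M₀ * M₂ - M₁ ^ 2) / M₀ ^ 2)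
        (((M₃ * M₀ ^ 2 - M₁ ^ 3) - 3 * M₁ * (M₀ * M₂ - M₁ ^ 2)) / M₀ ^ 3)
        ((-3 * M₁ ^ 4 + M₄ * M₀ ^ 3 - 4 * M₀ ^ 2 * M₁ * M₃ + 6 * M₀ * M₁ ^ 2 * M₂) / M₀ ^ 4)
        (ρ₁ / M₀) (ρ₂ / M₀) (v₁ - M₁ / M₀) (v₂ - M₁ / M₀) σ := by
  have hM : M₀ ≠ 0 := hM₀.ne'
  have he : (M₀ * M₂ - M₁ ^ 2) / M₀ ^ 2 = M₂ / M₀ - (M₁ / M₀) ^ 2 := by field_simp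
  have hq : ((M₃ * M₀ ^ 2 - M₁ ^ 3) - 3 * M₁ * (M₀ * M₂ - M₁ ^ 2)) / M₀ ^ 3
      = M₃ / M₀ - 3 * (M₁ / M₀) * (M₂ / M₀) + 2 * (M₁ / M₀) ^ 3 := by
    field_simp
    ring
  have hη : (-3 * M₁ ^ 4 + M₄ * M₀ ^ 3 - 4 * M₀ ^ 2 * M₁ * M₃ + 6 * M₀ * M₁ ^ 2 * M₂) / M₀ ^ 4
      = M₄ / M₀ - 4 * (M₁ / M₀) * (M₃ / M₀) + 6 * (M₁ / M₀) ^ 2 * (M₂ / M₀)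
        - 3 * (M₁ / M₀) ^ 4 := by
    field_simp
    ring
  have scale (a b x y c d : ℝ) (h : c / M₀ = d) :
      c = a * x + b * y ↔ a / M₀ * x + b / M₀ * y = d := by
    rw [← h, div_mul_eq_mul_div, div_mul_eq_mul_div, ← add_div, div_left_inj' hM, eq_comm]
  rw [he, hq, hη, ← centeredEQMOM_of_unit_mass]
  refine and_congr ?_ (and_congr (scale _ _ _ _ _ _ rfl) (and_congr (scale _ _ _ _ _ _ ?_)
    (and_congr (scale _ _ _ _ _ _ ?_) (scale _ _ _ _ _ _ ?_))))
  · rw [← add_div, div_eq_one_iff_eq hM, eq_comm]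
  all_goals field_simp
end

section
/- (Necessary cubic equation for the spread parameter.) If (ρ₁, ρ₂, v₁, v₂, σ) ∈ ℝ⁵ solves the centered two-node Gaussian-EQMOM system with parameters (e, q, η), then v₁v₂ = σ² − e, and σ₀ := σ² − e is a root of the cubic 𝒫, i.e. 2(σ²−e)³ + (η−3e²)(σ²−e) + q² = 0. -/
/-- Necessary cubic equation for the spread parameter:
`σ₀ := σ² − e` is a root of `𝒫(x) = 2x³ + (η−3e²)x + q²`. -/
theorem spread_cubic (e q η ρ₁ ρ₂ v₁ v₂ σ : ℝ)
    (h : CenteredEQMOM e q η ρ₁ ρ₂ v₁ v₂ σ) :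
    v₁ * v₂ = σ ^ 2 - e ∧
    2 * (σ ^ 2 - e) ^ 3 + (η - 3 * e ^ 2) * (σ ^ 2 - e) + q ^ 2 = 0 := by
  obtain ⟨h₀, h₁, h₂, h₃, h₄⟩ := h
  have hp : v₁ * v₂ = σ ^ 2 - e := by
    linear_combination (-(v₁ * v₂)) * h₀ + (v₁ + v₂) * h₁ - h₂
  have hq : q = -(v₁ + v₂) * (σ ^ 2 - e) := by
    linear_combination (v₁ + v₂) * h₂ - v₁ * v₂ * h₁ - h₃
  have hη : η - 3 * e ^ 2 = -(v₁ + v₂) ^ 2 * (σ ^ 2 - e) - 2 * (σ ^ 2 - e) ^ 2 := by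
    linear_combination (v₁ + v₂) * h₃ - v₁ * v₂ * h₂ - h₄ + (v₁ + v₂) * hq + (σ ^ 2 - e) * hp
  refine ⟨hp, ?_⟩
  rw [hη, hq]
  ring
end

section
/- (Symmetric structure in the case q = 0.) Suppose ρ₁ > 0, ρ₂ > 0 and (ρ₁, ρ₂, v₁, v₂, σ) solves the centered two-node Gaussian-EQMOM system with parameters (e, 0, η), and suppose e − σ² > 0. Then v₁ = −v₂ ≠ 0 and ρ₁ = ρ₂ = 1/2. -/
/-- Symmetric structure in the case `q = 0`. -/
theorem symmetric_case_q_zero (e η ρ₁ ρ₂ v₁ v₂ σ : ℝ)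
    (hρ₁ : 0 < ρ₁) (hρ₂ : 0 < ρ₂)
    (h : CenteredEQMOM e 0 η ρ₁ ρ₂ v₁ v₂ σ)
    (he : 0 < e - σ ^ 2) :
    v₁ = -v₂ ∧ v₂ ≠ 0 ∧ ρ₁ = 1 / 2 ∧ ρ₂ = 1 / 2 := by
  obtain ⟨h₀, h₁, h₂, h₃, -⟩ := h
  have hprod : (v₁ + v₂) * (e - σ ^ 2) = 0 := by
    linear_combination h₃ + v₁ * v₂ * h₁ - (v₁ + v₂) * h₂
  have hv : v₁ = -v₂ :=
    eq_neg_of_add_eq_zero_left ((mul_eq_zero.mp hprod).resolve_right he.ne')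
  subst hv
  have hv₂ : v₂ ≠ 0 := by
    rintro rfl
    norm_num at h₂
    linarith
  have hρ : ρ₂ - ρ₁ = 0 := by
    have hmul : (ρ₂ - ρ₁) * v₂ = 0 := by linear_combination h₁
    exact (mul_eq_zero.mp hmul).resolve_right hv₂
  exact ⟨rfl, hv₂, by linarith, by linarith⟩
end

section
/- (Localization of the negative root.) Let e > 0, q ≠ 0 and η ∈ ℝ, and let x₀ be the unique negative real root of the cubic 𝒫. Then x₀ > −e if and only if 𝒫(−e) < 0, which holds if and only if η > e² + q²/e. -/
/-- Localization of the unique negative root `x₀` of the cubic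
`𝒫(x) = 2x³ + (η−3e²)x + q²`. -/
theorem cubic_root_localization (e q η x₀ : ℝ) (he : 0 < e) (hq : q ≠ 0)
    (hneg : x₀ < 0)
    (hroot : 2 * x₀ ^ 3 + (η - 3 * e ^ 2) * x₀ + q ^ 2 = 0) :
    (-e < x₀ ↔ 2 * (-e) ^ 3 + (η - 3 * e ^ 2) * (-e) + q ^ 2 < 0) ∧
    (2 * (-e) ^ 3 + (η - 3 * e ^ 2) * (-e) + q ^ 2 < 0 ↔ e ^ 2 + q ^ 2 / e < η) := by
  have hfactor : x₀ * (2 * (-e) ^ 3 + (η - 3 * e ^ 2) * (-e) + q ^ 2) =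
      (x₀ + e) * (2 * e * (x₀ * (x₀ - e)) + q ^ 2) := by
    linear_combination (-e) * hroot
  have hpos : 0 < 2 * e * (x₀ * (x₀ - e)) + q ^ 2 := by
    have : 0 < x₀ * (x₀ - e) := mul_pos_of_neg_of_neg hneg (by linarith)
    positivity
  constructor
  · rw [neg_lt_iff_pos_add, ← mul_pos_iff_of_pos_right hpos, ← hfactor, mul_pos_iff]
    simp only [hneg, hneg.not_gt, false_and, true_and, false_or]
  · have hscale : 2 * (-e) ^ 3 + (η - 3 * e ^ 2) * (-e) + q ^ 2 =
        e * (e ^ 2 + q ^ 2 / e - η) := by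
      field_simp
      ring
    rw [hscale, mul_neg_iff]
    simp only [he, he.not_gt, false_and, true_and, or_false, sub_neg]
end

section
/- (Theorem 3.2, degenerate case v₁ = v₂.) Let σ ≠ 0 be real. Then the polynomial Y⁵ − 10σ²Y³ + 15σ⁴Y factors as Y·(Y² − (5+√10)σ²)·(Y² − (5−√10)σ²) and has five distinct real roots, namely 0, ±σ√(5+√10) and ±σ√(5−√10). Consequently, if v₁ = v₂ (so that v̄ = v₁ = v₂), the Gaussian-EQMOM characteristic polynomial satisfies P(Y + v̄) = Y⁵ − 10σ²Y³ + 15σ⁴Y for all Y, and P has five distinct real roots. -/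
/-- The characteristic polynomial `P(X) = X⁵ − εX⁴ − δX³ − γX² − βX − α` of the
two-node Gaussian-EQMOM five-moment system, built from `(ρ₁, ρ₂, v₁, v₂, σ)`. -/
noncomputable def Pchar (ρ₁ ρ₂ v₁ v₂ σ : ℝ) (X : ℝ) : ℝ :=
  let s₀ := v₁ * v₂
  let s₁ := -(v₁ + v₂)
  let vb := (ρ₁ * v₁ + ρ₂ * v₂) / (ρ₁ + ρ₂)
  let w := (ρ₁ * v₁ ^ 2 + ρ₂ * v₂ ^ 2) / (ρ₁ + ρ₂)
  let ε := -2 * s₁ + vb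
  let δ := -s₁ ^ 2 - 4 * s₀ - 2 * w + 10 * σ ^ 2
  let γ := -3 * s₀ * s₁ - s₁ * w + 2 * s₀ * vb + 6 * σ ^ 2 * (2 * s₁ - vb)
  let β := -2 * s₀ * w - 3 * s₀ ^ 2 + 3 * σ ^ 2 * (s₁ ^ 2 + 2 * w + 4 * s₀) - 15 * σ ^ 4
  let α := s₀ ^ 2 * vb + σ ^ 2 * (3 * s₀ * s₁ + s₁ * w - 2 * s₀ * vb)
            - 3 * σ ^ 4 * (2 * s₁ - vb)
  X ^ 5 - ε * X ^ 4 - δ * X ^ 3 - γ * X ^ 2 - β * X - α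

theorem injective_zero_pm_pm {a b : ℝ} (ha : a ≠ 0) (hb : b ≠ 0) (hab : a ^ 2 ≠ b ^ 2) :
    Function.Injective ![(0 : ℝ), a, -a, b, -b] := by
  have hsub : a - b ≠ 0 := fun h => hab (by rw [sub_eq_zero.mp h])
  have hadd : a + b ≠ 0 := fun h => hab (by rw [eq_neg_of_add_eq_zero_left h, neg_sq])
  intro i j hij
  fin_cases i <;> fin_cases j <;> simp at hij ⊢ <;> grind

theorem quintic_factor (σ Y : ℝ) :
    Y ^ 5 - 10 * σ ^ 2 * Y ^ 3 + 15 * σ ^ 4 * Y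
      = Y * (Y ^ 2 - (5 + Real.sqrt 10) * σ ^ 2)
          * (Y ^ 2 - (5 - Real.sqrt 10) * σ ^ 2) := by
  have h : Real.sqrt 10 ^ 2 = 10 := Real.sq_sqrt (by norm_num)
  linear_combination Y * σ ^ 4 * h

theorem Pchar_add_of_eq {ρ₁ ρ₂ : ℝ} (hρ : ρ₁ + ρ₂ ≠ 0) (v σ Y : ℝ) :
    Pchar ρ₁ ρ₂ v v σ (Y + v) = Y ^ 5 - 10 * σ ^ 2 * Y ^ 3 + 15 * σ ^ 4 * Y := by
  simp only [Pchar, ← add_mul, mul_div_cancel_left₀ _ hρ]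
  ring

/-- Theorem 3.2, degenerate case `v₁ = v₂`. -/
theorem hyperbolicity_degenerate (σ : ℝ) (hσ : σ ≠ 0) (ρ₁ ρ₂ vb : ℝ)
    (hρ : ρ₁ + ρ₂ ≠ 0) :
    (∀ Y : ℝ, Y ^ 5 - 10 * σ ^ 2 * Y ^ 3 + 15 * σ ^ 4 * Y
      = Y * (Y ^ 2 - (5 + Real.sqrt 10) * σ ^ 2)
          * (Y ^ 2 - (5 - Real.sqrt 10) * σ ^ 2)) ∧
    (Function.Injective
        ![(0 : ℝ), σ * Real.sqrt (5 + Real.sqrt 10), -(σ * Real.sqrt (5 + Real.sqrt 10)),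
          σ * Real.sqrt (5 - Real.sqrt 10), -(σ * Real.sqrt (5 - Real.sqrt 10))] ∧
      ∀ i : Fin 5,
        (![(0 : ℝ), σ * Real.sqrt (5 + Real.sqrt 10), -(σ * Real.sqrt (5 + Real.sqrt 10)),
          σ * Real.sqrt (5 - Real.sqrt 10), -(σ * Real.sqrt (5 - Real.sqrt 10))] i) ^ 5
          - 10 * σ ^ 2 * (![(0 : ℝ), σ * Real.sqrt (5 + Real.sqrt 10),
              -(σ * Real.sqrt (5 + Real.sqrt 10)), σ * Real.sqrt (5 - Real.sqrt 10),
              -(σ * Real.sqrt (5 - Real.sqrt 10))] i) ^ 3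
          + 15 * σ ^ 4 * (![(0 : ℝ), σ * Real.sqrt (5 + Real.sqrt 10),
              -(σ * Real.sqrt (5 + Real.sqrt 10)), σ * Real.sqrt (5 - Real.sqrt 10),
              -(σ * Real.sqrt (5 - Real.sqrt 10))] i) = 0) ∧
    (∀ Y : ℝ, Pchar ρ₁ ρ₂ vb vb σ (Y + vb)
        = Y ^ 5 - 10 * σ ^ 2 * Y ^ 3 + 15 * σ ^ 4 * Y) ∧
    (∃ r : Fin 5 → ℝ, Function.Injective r ∧ ∀ i, Pchar ρ₁ ρ₂ vb vb σ (r i) = 0) := by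
  have h10 : 0 < Real.sqrt 10 := Real.sqrt_pos.mpr (by norm_num)
  have h5 : Real.sqrt 10 < 5 := (Real.sqrt_lt' (by norm_num)).mpr (by norm_num)
  have ha := Real.sq_sqrt (show 0 ≤ 5 + Real.sqrt 10 by linarith)
  have hb := Real.sq_sqrt (show 0 ≤ 5 - Real.sqrt 10 by linarith)
  have hinj := injective_zero_pm_pm
    (a := σ * Real.sqrt (5 + Real.sqrt 10)) (b := σ * Real.sqrt (5 - Real.sqrt 10))
    (mul_ne_zero hσ (Real.sqrt_pos.mpr (by linarith)).ne')
    (mul_ne_zero hσ (Real.sqrt_pos.mpr (by linarith)).ne')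
    (by
      rw [mul_pow, mul_pow, ha, hb]
      intro h
      have := mul_left_cancel₀ (pow_ne_zero 2 hσ) h
      linarith)
  have hroot : ∀ i : Fin 5, ∀ Y, Y = ![(0 : ℝ), σ * Real.sqrt (5 + Real.sqrt 10),
      -(σ * Real.sqrt (5 + Real.sqrt 10)), σ * Real.sqrt (5 - Real.sqrt 10),
      -(σ * Real.sqrt (5 - Real.sqrt 10))] i →
      Y ^ 5 - 10 * σ ^ 2 * Y ^ 3 + 15 * σ ^ 4 * Y = 0 := by
    rintro i Y rfl
    rw [quintic_factor]
    fin_cases i <;> simp [mul_pow, ha, hb, mul_comm]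
  exact ⟨quintic_factor σ, ⟨hinj, fun i => hroot i _ rfl⟩, Pchar_add_of_eq hρ vb σ,
    fun i => _ + vb, (add_left_injective vb).comp hinj,
    fun i => (Pchar_add_of_eq hρ vb σ _).trans (hroot i _ rfl)⟩
end

section
/- (Theorem 3.2, nondegenerate case: distinct real roots of the reduced quintic.) Let ρ₁ > 0, ρ₂ > 0 and Σ ≠ 0 be real. Then the quintic Q(Z) has five distinct real roots. -/
/-- The reduced quintic `Q(Z)` built from `(ρ₁, ρ₂, Σ)`. -/
def Qquintic (ρ₁ ρ₂ S Z : ℝ) : ℝ :=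
  Z ^ 5 + 2 * (ρ₂ - ρ₁) * Z ^ 4
    + (ρ₁ ^ 2 - 4 * ρ₁ * ρ₂ + ρ₂ ^ 2 - 10 * S ^ 2) * Z ^ 3
    - 2 * (ρ₂ - ρ₁) * (ρ₁ * ρ₂ + 6 * S ^ 2) * Z ^ 2
    + (ρ₁ ^ 2 * ρ₂ ^ 2 - 3 * (ρ₁ ^ 2 - 4 * ρ₁ * ρ₂ + ρ₂ ^ 2) * S ^ 2 + 15 * S ^ 4) * Z
    + 2 * (ρ₂ - ρ₁) * (ρ₁ * ρ₂ + 3 * S ^ 2) * S ^ 2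

section

open Polynomial

/-- A monic real polynomial all of whose roots are real and simple. -/
def IsSimplyRealRooted (p : ℝ[X]) : Prop :=
  p.Monic ∧ p.Splits ∧ ∀ x, p.eval x = 0 → p.derivative.eval x ≠ 0

/-- The operator `X - c - s • d/dX`. It satisfies
`exp (-s D ^ 2 / 2) ((X - c) p) = raise s c (exp (-s D ^ 2 / 2) p)`. -/
noncomputable def raise (s c : ℝ) (p : ℝ[X]) : ℝ[X] :=
  (X - C c) * p - C s * derivative p

theorem laguerre_inequality_prod (m : Multiset ℝ) (x : ℝ) :
    (m.map fun a => X - C a).prod.eval x *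
        (derivative (derivative (m.map fun a => X - C a).prod)).eval x ≤
      (derivative (m.map fun a => X - C a).prod).eval x ^ 2 := by
  induction m using Multiset.induction_on with
  | empty => simp
  | cons a m ih =>
    simp only [Multiset.map_cons, Multiset.prod_cons]
    generalize (m.map fun a => X - C a).prod = u at ih ⊢
    simp only [derivative_mul, derivative_add, derivative_sub, derivative_X, derivative_C, eval_add,
      eval_sub, eval_mul, eval_X, eval_C, sub_zero, one_mul]
    nlinarith [mul_le_mul_of_nonneg_left ih (sq_nonneg (x - a)), sq_nonneg (u.eval x)]

theorem Polynomial.Splits.im_mul_im_logDeriv_nonpos {p : ℝ[X]} (hp : p.Splits) {z : ℂ}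
    (hz : (p.map Complex.ofRealHom).eval z ≠ 0) :
    z.im * ((p.map Complex.ofRealHom).derivative.eval z /
      (p.map Complex.ofRealHom).eval z).im ≤ 0 := by
  rw [(hp.map Complex.ofRealHom).eval_derivative_div_eval_of_ne_zero hz, hp.roots_map]
  induction p.roots using Multiset.induction_on with
  | empty => simp
  | cons a m ih =>
    simp only [Multiset.map_cons, Multiset.sum_cons, Complex.add_im, mul_add]
    refine add_nonpos ?_ ih
    have h : z.im * (1 / (z - Complex.ofRealHom a)).im =
        -(z.im ^ 2 / Complex.normSq (z - Complex.ofRealHom a)) := by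
      simp [Complex.inv_im]
      ring
    rw [h]
    exact neg_nonpos.2 (div_nonneg (sq_nonneg _) (Complex.normSq_nonneg _))

theorem degree_C_mul_derivative_lt {p : ℝ[X]} (hp : p.Monic) (s c : ℝ) :
    (C s * derivative p).degree < ((X - C c) * p).degree := by
  have hC : (C s * derivative p).degree ≤ (derivative p).degree := by
    simpa [smul_eq_C_mul] using degree_smul_le s (derivative p)
  refine (hC.trans_lt (degree_derivative_lt hp.ne_zero)).trans_le ?_
  rw [mul_comm]
  exact degree_le_mul_left p (X_sub_C_ne_zero c)

theorem natDegree_raise {p : ℝ[X]} (hp : p.Monic) (s c : ℝ) :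
    (raise s c p).natDegree = p.natDegree + 1 := by
  rw [raise, natDegree_eq_of_degree_eq (degree_sub_eq_left_of_degree_lt
    (degree_C_mul_derivative_lt hp s c)), (monic_X_sub_C c).natDegree_mul hp, natDegree_X_sub_C,
    add_comm]

theorem Polynomial.Splits.raise {p : ℝ[X]} (hp : p.Splits) (hp0 : p ≠ 0) {s : ℝ}
    (hs : 0 < s) (c : ℝ) : (raise s c p).Splits := by
  refine Splits.of_splits_map Complex.ofRealHom (IsAlgClosed.splits _) fun z hz => ?_
  by_cases h0 : (p.map Complex.ofRealHom).eval z = 0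
  · exact hp.mem_range_of_isRoot hp0 h0
  refine ⟨z.re, Complex.ext rfl ?_⟩
  have h := isRoot_of_mem_roots hz
  simp only [_root_.raise, IsRoot, Polynomial.map_sub, Polynomial.map_mul, map_X, map_C, eval_sub,
    eval_mul, eval_X, eval_C, ← derivative_map] at h
  have hdiv : z - c = s * ((p.map Complex.ofRealHom).derivative.eval z /
      (p.map Complex.ofRealHom).eval z) := by
    field_simp
    exact sub_eq_zero.1 h
  have him := congrArg Complex.im hdiv
  rw [Complex.im_ofReal_mul, Complex.sub_im, Complex.ofReal_im, sub_zero] at him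
  have hle := hp.im_mul_im_logDeriv_nonpos h0
  have hsq : z.im ^ 2 ≤ 0 := by
    nth_rewrite 1 [sq, him]
    nlinarith
  exact (pow_eq_zero_iff two_ne_zero).1 (le_antisymm hsq (sq_nonneg _)) |>.symm

theorem IsSimplyRealRooted.raise {p : ℝ[X]} (hp : IsSimplyRealRooted p) {s : ℝ} (hs : 0 < s)
    (c : ℝ) : IsSimplyRealRooted (raise s c p) := by
  obtain ⟨hm, hsplit, hr⟩ := hp
  refine ⟨((monic_X_sub_C c).mul hm).sub_of_left (degree_C_mul_derivative_lt hm s c),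
    hsplit.raise hm.ne_zero hs c, fun x hx hx' => ?_⟩
  have hL := laguerre_inequality_prod p.roots x
  rw [← hsplit.eq_prod_roots_of_monic hm] at hL
  simp only [_root_.raise, derivative_mul, derivative_sub, derivative_X, derivative_C, eval_add,
    eval_sub, eval_mul, eval_X, eval_C, sub_zero, one_mul, zero_mul, zero_add] at hx hx'
  have hp0 : p.eval x = 0 := by
    have key : p.eval x ^ 2 + s * (p.derivative.eval x ^ 2 -
        p.eval x * p.derivative.derivative.eval x) = 0 := by
      linear_combination p.eval x * hx' - p.derivative.eval x * hx
    exact (pow_eq_zero_iff two_ne_zero).1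
      (le_antisymm (by nlinarith [mul_nonneg hs.le (sub_nonneg.2 hL)]) (sq_nonneg _))
  refine hr x hp0 ?_
  simpa [hp0, hs.ne'] using hx

theorem IsSimplyRealRooted.exists_injective_roots {p : ℝ[X]} (hp : IsSimplyRealRooted p) {n : ℕ}
    (hn : p.natDegree = n) :
    ∃ r : Fin n → ℝ, Function.Injective r ∧ ∀ i, p.eval (r i) = 0 := by
  obtain ⟨hm, hsplit, hr⟩ := hp
  have hnodup : p.roots.Nodup := by
    refine Multiset.nodup_iff_count_le_one.2 fun x => ?_
    rw [count_roots]
    by_contra! h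
    obtain ⟨h0, h1⟩ := (one_lt_rootMultiplicity_iff_isRoot hm.ne_zero).1 h
    exact hr x h0 h1
  have hcard : p.roots.toFinset.card = n := by
    rw [Multiset.toFinset_card_of_nodup hnodup, ← hsplit.natDegree_eq_card_roots, hn]
  refine ⟨p.roots.toFinset.orderEmbOfFin hcard, (p.roots.toFinset.orderEmbOfFin hcard).injective,
    fun i => ?_⟩
  exact isRoot_of_mem_roots (Multiset.mem_toFinset.1 (Finset.orderEmbOfFin_mem _ hcard i))

theorem isSimplyRealRooted_one : IsSimplyRealRooted 1 :=
  ⟨monic_one, Splits.one, by simp⟩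

theorem eval_raise_eq_Qquintic (ρ₁ ρ₂ S x : ℝ) :
    (raise (S ^ 2) 0 (raise (S ^ 2) ρ₁ (raise (S ^ 2) ρ₁ (raise (S ^ 2) (-ρ₂)
      (raise (S ^ 2) (-ρ₂) 1))))).eval x = Qquintic ρ₁ ρ₂ S x := by
  simp only [raise, Qquintic, derivative_mul, derivative_sub, derivative_add, derivative_X,
    derivative_C, derivative_one, derivative_zero, eval_add, eval_sub, eval_mul, eval_X, eval_C,
    eval_one, eval_zero]
  ring

end

/-- Theorem 3.2, nondegenerate case: the reduced quintic has five distinct real roots. -/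
theorem reduced_quintic_distinct_roots (ρ₁ ρ₂ S : ℝ)
    (hρ₁ : 0 < ρ₁) (hρ₂ : 0 < ρ₂) (hS : S ≠ 0) :
    ∃ r : Fin 5 → ℝ, Function.Injective r ∧ ∀ i, Qquintic ρ₁ ρ₂ S (r i) = 0 := by
  have hs : 0 < S ^ 2 := by positivity
  have h₁ := isSimplyRealRooted_one.raise hs (-ρ₂)
  have h₂ := h₁.raise hs (-ρ₂)
  have h₃ := h₂.raise hs ρ₁
  have h₄ := h₃.raise hs ρ₁
  have hdeg := natDegree_raise h₄.1 (S ^ 2) 0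
  rw [natDegree_raise h₃.1, natDegree_raise h₂.1, natDegree_raise h₁.1,
    natDegree_raise Polynomial.monic_one, Polynomial.natDegree_one] at hdeg
  obtain ⟨r, hr, hroot⟩ := (h₄.raise hs 0).exists_injective_roots hdeg
  exact ⟨r, hr, fun i => by rw [← eval_raise_eq_Qquintic, hroot i]⟩
end

section
/- (Change of variables relating the characteristic polynomial P to the reduced quintic Q.) Let ρ₁, ρ₂, v₁, v₂, σ be real with ρ₁+ρ₂ ≠ 0 and v₁ ≠ v₂, and set c = (v₂−v₁)/(ρ₁+ρ₂) and Σ = (ρ₁+ρ₂)σ/(v₂−v₁). Then for all Z ∈ ℝ, P(v̄ + cZ) = c⁵ · Q(Z), where P is the Gaussian-EQMOM characteristic polynomial built from (ρ₁, ρ₂, v₁, v₂, σ) and Q is the reduced quintic built from (ρ₁, ρ₂, Σ). -/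
/-- Change of variables relating the characteristic polynomial `P` to the
reduced quintic `Q`. -/
theorem change_of_variables_P_Q (ρ₁ ρ₂ v₁ v₂ σ : ℝ)
    (hρ : ρ₁ + ρ₂ ≠ 0) (hv : v₁ ≠ v₂) :
    ∀ Z : ℝ,
      Pchar ρ₁ ρ₂ v₁ v₂ σ
        ((ρ₁ * v₁ + ρ₂ * v₂) / (ρ₁ + ρ₂) + (v₂ - v₁) / (ρ₁ + ρ₂) * Z)
      = ((v₂ - v₁) / (ρ₁ + ρ₂)) ^ 5
          * Qquintic ρ₁ ρ₂ ((ρ₁ + ρ₂) * σ / (v₂ - v₁)) Z := by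
  intro Z
  have hd : v₂ - v₁ ≠ 0 := sub_ne_zero.mpr hv.symm
  have hw : (ρ₁ * v₁ ^ 2 + ρ₂ * v₂ ^ 2) / (ρ₁ + ρ₂)
      = ((ρ₁ * v₁ + ρ₂ * v₂) / (ρ₁ + ρ₂)) ^ 2
        + ((v₂ - v₁) / (ρ₁ + ρ₂)) ^ 2 * (ρ₁ * ρ₂) := by
    field_simp
    ring
  have h₁ : v₁ = (ρ₁ * v₁ + ρ₂ * v₂) / (ρ₁ + ρ₂) - (v₂ - v₁) / (ρ₁ + ρ₂) * ρ₂ := by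
    field_simp
    ring
  have h₂ : v₂ = (ρ₁ * v₁ + ρ₂ * v₂) / (ρ₁ + ρ₂) + (v₂ - v₁) / (ρ₁ + ρ₂) * ρ₁ := by
    field_simp
    ring
  have hσ : σ = (v₂ - v₁) / (ρ₁ + ρ₂) * ((ρ₁ + ρ₂) * σ / (v₂ - v₁)) := by
    field_simp
  simp only [Pchar, Qquintic, hw]
  generalize (ρ₁ * v₁ + ρ₂ * v₂) / (ρ₁ + ρ₂) = m at h₁ h₂ ⊢
  generalize (ρ₁ + ρ₂) * σ / (v₂ - v₁) = S at hσ ⊢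
  generalize (v₂ - v₁) / (ρ₁ + ρ₂) = c at h₁ h₂ hσ ⊢
  rw [h₁, h₂, hσ]
  ring
end

section
/- (Theorem 3.2: hyperbolicity of the 1-D five-moment Gaussian-EQMOM system.) Let ρ₁ > 0, ρ₂ > 0, σ > 0 and v₁, v₂ ∈ ℝ. Then the Gaussian-EQMOM characteristic polynomial P(X) has five distinct real roots; consequently the 5×5 Jacobian matrix J, whose first four rows have a 1 on the superdiagonal and zeros elsewhere and whose last row is (α, β, γ, δ, ε), is diagonalizable over ℝ with five distinct real eigenvalues. -/
/-- The companion-type Jacobian matrix `J` of the two-node Gaussian-EQMOM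
five-moment system: the first four rows have a `1` on the superdiagonal and
zeros elsewhere, and the last row is `(α, β, γ, δ, ε)`. -/
noncomputable def Jmat (ρ₁ ρ₂ v₁ v₂ σ : ℝ) : Matrix (Fin 5) (Fin 5) ℝ :=
  let s₀ := v₁ * v₂
  let s₁ := -(v₁ + v₂)
  let vb := (ρ₁ * v₁ + ρ₂ * v₂) / (ρ₁ + ρ₂)
  let w := (ρ₁ * v₁ ^ 2 + ρ₂ * v₂ ^ 2) / (ρ₁ + ρ₂)
  let ε := -2 * s₁ + vb
  let δ := -s₁ ^ 2 - 4 * s₀ - 2 * w + 10 * σ ^ 2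
  let γ := -3 * s₀ * s₁ - s₁ * w + 2 * s₀ * vb + 6 * σ ^ 2 * (2 * s₁ - vb)
  let β := -2 * s₀ * w - 3 * s₀ ^ 2 + 3 * σ ^ 2 * (s₁ ^ 2 + 2 * w + 4 * s₀) - 15 * σ ^ 4
  let α := s₀ ^ 2 * vb + σ ^ 2 * (3 * s₀ * s₁ + s₁ * w - 2 * s₀ * vb)
            - 3 * σ ^ 4 * (2 * s₁ - vb)
  Matrix.of fun i j =>
    if (i : ℕ) < 4 then (if (j : ℕ) = (i : ℕ) + 1 then (1 : ℝ) else 0)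
    else ![α, β, γ, δ, ε] j

open Filter Topology Set in
/-- **Rolle's theorem** on the half-line `(a, ∞)`. -/
theorem exists_hasDerivAt_eq_zero_Ioi {f f' : ℝ → ℝ} {a l : ℝ}
    (hfa : Tendsto f (𝓝[>] a) (𝓝 l)) (hft : Tendsto f atTop (𝓝 l))
    (hff' : ∀ x ∈ Ioi a, HasDerivAt f (f' x) x) : ∃ c ∈ Ioi a, f' c = 0 := by
  have hpos : ∀ t ∈ Ioo 0 (Real.pi / 2), a < a + Real.tan t := fun t ht =>
    lt_add_of_pos_right a (Real.tan_pos_of_pos_of_lt_pi_div_two ht.1 ht.2)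
  have hcos : ∀ t ∈ Ioo 0 (Real.pi / 2), 0 < Real.cos t := fun t ht =>
    Real.cos_pos_of_mem_Ioo ⟨by linarith [ht.1, ht.2], ht.2⟩
  have hzero : Tendsto (fun t => a + Real.tan t) (𝓝[>] 0) (𝓝[>] a) := by
    refine tendsto_nhdsWithin_iff.2 ⟨?_, ?_⟩
    · have h : ContinuousAt (fun t => a + Real.tan t) 0 :=
        continuousAt_const.add (Real.continuousAt_tan.2 (by simp))
      simpa [ContinuousAt] using h.tendsto.mono_left nhdsWithin_le_nhds
    · filter_upwards [Ioo_mem_nhdsGT Real.pi_div_two_pos] with t ht using hpos t ht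
  obtain ⟨t, ht, h⟩ := exists_hasDerivAt_eq_zero' Real.pi_div_two_pos (hfa.comp hzero)
    (hft.comp (tendsto_atTop_add_const_left _ a Real.tendsto_tan_pi_div_two))
    (fun t ht => (hff' _ (hpos t ht)).comp t
      ((Real.hasDerivAt_tan (hcos t ht).ne').const_add a))
  refine ⟨a + Real.tan t, hpos t ht, (mul_eq_zero.1 h).resolve_right ?_⟩
  exact one_div_ne_zero (pow_ne_zero 2 (hcos t ht).ne')

open Filter Topology Set in
/-- **Rolle's theorem** on the half-line `(-∞, a)`. -/
theorem exists_hasDerivAt_eq_zero_Iio {f f' : ℝ → ℝ} {a l : ℝ}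
    (hfa : Tendsto f (𝓝[<] a) (𝓝 l)) (hfb : Tendsto f atBot (𝓝 l))
    (hff' : ∀ x ∈ Iio a, HasDerivAt f (f' x) x) : ∃ c ∈ Iio a, f' c = 0 := by
  have hneg : Tendsto (fun x : ℝ => -x) (𝓝[>] (-a)) (𝓝[<] a) := by
    simpa using tendsto_neg_nhdsGT (a := -a)
  obtain ⟨c, hc, h⟩ := exists_hasDerivAt_eq_zero_Ioi (a := -a) (hfa.comp hneg)
    (hfb.comp tendsto_neg_atTop_atBot)
    (fun x (hx : -a < x) =>
      (hff' (-x) (show -x < a by linarith)).comp x (hasDerivAt_neg x))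
  exact ⟨-c, show -c < a by linarith [mem_Ioi.1 hc], by simpa using h⟩

open Filter Topology Polynomial in
/-- A polynomial times a Gaussian vanishes at infinity. -/
theorem Polynomial.tendsto_eval_mul_exp_neg_mul_sq_cocompact (p : ℝ[X]) (a : ℝ) {b : ℝ}
    (hb : 0 < b) :
    Tendsto (fun x => p.eval x * Real.exp (-b * (x - a) ^ 2)) (cocompact ℝ) (𝓝 0) := by
  have centred : ∀ q : ℝ[X],
      Tendsto (fun x => q.eval x * Real.exp (-b * x ^ 2)) (cocompact ℝ) (𝓝 0) := by
    intro q
    induction q using Polynomial.induction_on' with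
    | add q₁ q₂ h₁ h₂ => simpa [add_mul] using h₁.add h₂
    | monomial n k =>
      refine squeeze_zero_norm (fun x => ?_)
        (by simpa using (tendsto_rpow_abs_mul_exp_neg_mul_sq_cocompact hb n).const_mul |k|)
      simp [mul_assoc]
  have h := (centred (p.comp (X + C a))).comp
    (Homeomorph.subRight a).isClosedEmbedding.tendsto_cocompact
  simpa [Function.comp_def] using h

open Filter Topology Set Polynomial in
/-- If `p` has `n + 1` distinct real roots, then for `c > 0` the polynomial `(X - a) p - c p'`
has `n + 2` distinct real roots, which interlace those of `p`. -/
theorem Polynomial.exists_strictMono_roots_sub_derivative {n : ℕ} (p : ℝ[X]) (a : ℝ) {c : ℝ}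
    (hc : 0 < c) {r : Fin (n + 1) → ℝ} (hr : StrictMono r) (hp : ∀ i, p.eval (r i) = 0) :
    ∃ s : Fin (n + 2) → ℝ, StrictMono s ∧
      ∀ i, ((X - C a) * p - C c * derivative p).eval (s i) = 0 := by
  set f : ℝ → ℝ := fun x => p.eval x * Real.exp (-(1 / (2 * c)) * (x - a) ^ 2) with hf
  set g : ℝ → ℝ := fun x => ((X - C a) * p - C c * derivative p).eval x *
    (-(1 / c) * Real.exp (-(1 / (2 * c)) * (x - a) ^ 2)) with hg
  have hfg : ∀ x, HasDerivAt f (g x) x := by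
    intro x
    have h := (p.hasDerivAt x).mul
      ((((hasDerivAt_id x).sub_const a).pow 2).const_mul (-(1 / (2 * c)))).exp
    refine h.congr_deriv ?_
    simp [hg]
    field_simp
    ring
  have hroot : ∀ x, g x = 0 → ((X - C a) * p - C c * derivative p).eval x = 0 := by
    intro x hx
    refine (mul_eq_zero.1 hx).resolve_right ?_
    exact mul_ne_zero (neg_ne_zero.2 (one_div_ne_zero hc.ne')) (Real.exp_ne_zero _)
  have hcont : Continuous f := continuous_iff_continuousAt.2 fun x => (hfg x).continuousAt
  have hf0 : ∀ i, f (r i) = 0 := fun i => by simp [hf, hp i]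
  have hlim := p.tendsto_eval_mul_exp_neg_mul_sq_cocompact a (b := 1 / (2 * c)) (by positivity)
  have hnhds : ∀ i (s : Set ℝ), Tendsto f (𝓝[s] (r i)) (𝓝 0) := fun i s => by
    simpa [hf0 i] using (hcont.tendsto (r i)).mono_left nhdsWithin_le_nhds
  have hex : ∀ i : Fin (n + 2), ∃ x,
      (∀ j : Fin (n + 1), j.castSucc < i → r j < x) ∧
      (∀ j : Fin (n + 1), i ≤ j.castSucc → x < r j) ∧
      ((X - C a) * p - C c * derivative p).eval x = 0 := by
    intro i
    rcases Fin.eq_zero_or_eq_succ i with rfl | ⟨k, rfl⟩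
    · obtain ⟨x, hx, h⟩ := exists_hasDerivAt_eq_zero_Iio (hnhds 0 _)
        (hlim.mono_left atBot_le_cocompact) (fun x _ => hfg x)
      exact ⟨x, fun j hj => absurd hj (Fin.not_lt_zero _),
        fun j _ => lt_of_lt_of_le hx (hr.monotone (Fin.zero_le j)), hroot x h⟩
    · have hleft : ∀ {x}, r k < x → ∀ j : Fin (n + 1), j.castSucc < k.succ → r j < x :=
        fun hx j hj => lt_of_le_of_lt (hr.monotone (Fin.castSucc_lt_succ_iff.1 hj)) hx
      by_cases hk : (k : ℕ) < n
      · obtain ⟨x, hx, h⟩ := exists_hasDerivAt_eq_zero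
          (hr (show k < ⟨k + 1, by omega⟩ from Nat.lt_succ_self _)) hcont.continuousOn
          ((hf0 _).trans (hf0 _).symm) (fun x _ => hfg x)
        exact ⟨x, hleft hx.1, fun j hj => lt_of_lt_of_le hx.2 (hr.monotone hj), hroot x h⟩
      · obtain ⟨x, hx, h⟩ := exists_hasDerivAt_eq_zero_Ioi (hnhds k _)
          (hlim.mono_left atTop_le_cocompact) (fun x _ => hfg x)
        refine ⟨x, hleft hx, fun j hj => ?_, hroot x h⟩
        have : (k : ℕ) + 1 ≤ j := hj
        omega
  choose s hs₁ hs₂ hs₃ using hex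
  refine ⟨s, fun i k hik => ?_, hs₃⟩
  have hi : (i : ℕ) < n + 1 := by
    have : (i : ℕ) < k := hik
    omega
  exact (hs₂ i ⟨i, hi⟩ le_rfl).trans (hs₁ k ⟨i, hi⟩ hik)

open Polynomial in
/-- `Pchar` arises from `X - v̄` by four steps of the form `p ↦ (X - a) p - σ² p'`. -/
theorem exists_strictMono_Pchar_eq_zero (ρ₁ ρ₂ v₁ v₂ σ : ℝ) (hρ : ρ₁ + ρ₂ ≠ 0) (hσ : 0 < σ) :
    ∃ r : Fin 5 → ℝ, StrictMono r ∧ ∀ i, Pchar ρ₁ ρ₂ v₁ v₂ σ (r i) = 0 := by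
  set vb := (ρ₁ * v₁ + ρ₂ * v₂) / (ρ₁ + ρ₂) with hvb
  have hw : (ρ₁ * v₁ ^ 2 + ρ₂ * v₂ ^ 2) / (ρ₁ + ρ₂) = (v₁ + v₂) * vb - v₁ * v₂ := by
    rw [hvb]
    field_simp
    ring
  have hσ2 : 0 < σ ^ 2 := by positivity
  obtain ⟨r₂, hr₂, h₂⟩ := (X - C vb).exists_strictMono_roots_sub_derivative v₁ hσ2
    (r := fun _ : Fin 1 => vb) (fun i j hij => by omega) (by simp)
  obtain ⟨r₃, hr₃, h₃⟩ := Polynomial.exists_strictMono_roots_sub_derivative _ v₁ hσ2 hr₂ h₂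
  obtain ⟨r₄, hr₄, h₄⟩ := Polynomial.exists_strictMono_roots_sub_derivative _ v₂ hσ2 hr₃ h₃
  obtain ⟨r₅, hr₅, h₅⟩ := Polynomial.exists_strictMono_roots_sub_derivative _ v₂ hσ2 hr₄ h₄
  refine ⟨r₅, hr₅, fun i => (Eq.trans ?_ (h₅ i))⟩
  simp only [Pchar, hw, ← hvb]
  simp only [derivative_sub, derivative_mul, derivative_add, derivative_X, derivative_C,
    derivative_one, derivative_zero, eval_sub, eval_mul, eval_add, eval_X, eval_C, eval_one,
    eval_zero]
  ring

/-- The transposed Vandermonde matrix of roots of `Pchar` intertwines `Jmat` with the diagonal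
matrix of these roots. -/
theorem Jmat_mul_vandermonde_transpose {ρ₁ ρ₂ v₁ v₂ σ : ℝ} {r : Fin 5 → ℝ}
    (hr : ∀ i, Pchar ρ₁ ρ₂ v₁ v₂ σ (r i) = 0) :
    Jmat ρ₁ ρ₂ v₁ v₂ σ * (Matrix.vandermonde r).transpose =
      (Matrix.vandermonde r).transpose * Matrix.diagonal r := by
  ext i j
  rw [Matrix.mul_diagonal]
  have h := hr j
  simp only [Pchar] at h
  fin_cases i
  all_goals simp [Matrix.mul_apply, Fin.sum_univ_five, Jmat, Matrix.vandermonde_apply]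
  · ring
  · ring
  · ring
  · linear_combination -h

/-- Theorem 3.2: hyperbolicity of the 1-D five-moment Gaussian-EQMOM system. -/
theorem hyperbolicity_1D (ρ₁ ρ₂ v₁ v₂ σ : ℝ)
    (hρ₁ : 0 < ρ₁) (hρ₂ : 0 < ρ₂) (hσ : 0 < σ) :
    ∃ r : Fin 5 → ℝ, Function.Injective r ∧
      (∀ i, Pchar ρ₁ ρ₂ v₁ v₂ σ (r i) = 0) ∧
      ∃ S : Matrix (Fin 5) (Fin 5) ℝ, IsUnit S.det ∧
        S⁻¹ * Jmat ρ₁ ρ₂ v₁ v₂ σ * S = Matrix.diagonal r := by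
  obtain ⟨r, hr, hroot⟩ :=
    exists_strictMono_Pchar_eq_zero ρ₁ ρ₂ v₁ v₂ σ (add_pos hρ₁ hρ₂).ne' hσ
  have hdet : IsUnit (Matrix.vandermonde r).transpose.det := by
    rw [Matrix.det_transpose]
    exact (Matrix.det_vandermonde_ne_zero_iff.2 hr.injective).isUnit
  refine ⟨r, hr.injective, hroot, (Matrix.vandermonde r).transpose, hdet, ?_⟩
  rw [Matrix.mul_assoc, Jmat_mul_vandermonde_transpose hroot,
    Matrix.nonsing_inv_mul_cancel_left _ _ hdet]
end
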